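/- Let m ≥ 1 and N > 2m. There exists a constant C = C(m, N) > 0 with the following property. Let ρ > 0 and let a_{αβ} ∈ L^∞(ℝᴺ; ℂ), indexed by multi-indices α, β with |α| = |β| = m, satisfy Q₀(f,f) ≥ ρ ‖∇^m f‖_{L²}² for all f ∈ C_c^∞(ℝᴺ; ℂ). If V : ℝᴺ → ℝ is measurable with C ‖V‖_{L^{N/(2m),∞}} < ρ, then V is strongly subcritical relative to Q₀ with constant μ = C ‖V‖_{L^{N/(2m),∞}} / ρ < 1, i.e. ∫_{ℝᴺ} V₋ |f|² dx ≤ μ ( Q₀(f,f) + ∫_{ℝᴺ} V₊ |f|² dx ) for all f ∈ C_c^∞(ℝᴺ; ℂ). -/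

import Mathlib

open MeasureTheory
open scoped ENNReal NNReal

/-- The partial derivative `∂_i f` of a function on `ℝᴺ`. -/
noncomputable def pderivE {N : ℕ} (i : Fin N)
    (f : EuclideanSpace ℝ (Fin N) → ℂ) : EuclideanSpace ℝ (Fin N) → ℂ :=
  fun x => fderiv ℝ f x (EuclideanSpace.single i 1)

/-- The multi-index partial derivative `∂^α f = ∂_1^{α 1} ⋯ ∂_N^{α N} f`. -/
noncomputable def mderivE {N : ℕ} (α : Fin N → ℕ) :
    (EuclideanSpace ℝ (Fin N) → ℂ) → (EuclideanSpace ℝ (Fin N) → ℂ) :=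
  (List.finRange N).foldr (fun i G => (pderivE i)^[α i] ∘ G) id

/-- The finite set of multi-indices `α` on `Fin N` of total degree `m`. -/
noncomputable def multiIdx (N m : ℕ) : Finset (Fin N → ℕ) :=
  (Fintype.piFinset fun _ : Fin N => Finset.range (m + 1)).filter
    fun α => ∑ i, α i = m

/-- The sesquilinear form
`Q₀(f,g) = ∑_{|α|=|β|=m} ∫ a_{αβ}(x) ∂^β f(x) conj(∂^α g(x)) dx`. -/
noncomputable def Qform {N : ℕ} (m : ℕ)
    (a : (Fin N → ℕ) → (Fin N → ℕ) → EuclideanSpace ℝ (Fin N) → ℂ)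
    (f g : EuclideanSpace ℝ (Fin N) → ℂ) : ℂ :=
  ∑ α ∈ multiIdx N m, ∑ β ∈ multiIdx N m,
    ∫ x, a α β x * mderivE β f x * (starRingEnd ℂ) (mderivE α g x)

/-- The weak `L^r` quasinorm
`‖g‖_{L^{r,∞}} = sup_{γ>0} γ |{x : |g x| > γ}|^{1/r}`, valued in `ℝ≥0∞`. -/
noncomputable def weakLpNorm {α : Type*} [MeasurableSpace α]
    (μ : Measure α) (r : ℝ) (g : α → ℝ) : ℝ≥0∞ :=
  ⨆ (γ : ℝ) (_ : 0 < γ), ENNReal.ofReal γ * μ {x | γ < |g x|} ^ (1 / r)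

open Metric Set SchwartzMap FourierTransform LineDeriv

section FourierInequalities
variable {E : Type*} [NormedAddCommGroup E] [InnerProductSpace ℝ E] [FiniteDimensional ℝ E]
  [MeasurableSpace E] [BorelSpace E]

theorem lintegral_ball_norm_rpow_neg [Nontrivial E] {σ R : ℝ}
    (hσ : σ < Module.finrank ℝ E) (hR : 0 < R) :
    ∫⁻ ξ in ball (0 : E) R, ENNReal.ofReal (‖ξ‖ ^ (-σ)) =
      ENNReal.ofReal (Module.finrank ℝ E * volume.real (ball (0 : E) 1) /
        (Module.finrank ℝ E - σ) * R ^ (Module.finrank ℝ E - σ)) := by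
  set d := Module.finrank ℝ E with hd
  have hd1 : 1 ≤ d := Module.finrank_pos
  have hker : ∀ y : ℝ, 0 < y → y ^ (d - 1) • y ^ (-σ) = y ^ ((d : ℝ) - σ - 1) := by
    intro y hy
    rw [smul_eq_mul, ← Real.rpow_natCast, ← Real.rpow_add hy, Nat.cast_sub hd1]
    congr 1
    push_cast
    ring
  have hint : IntegrableOn (fun ξ : E => ‖ξ‖ ^ (-σ)) (ball 0 R) := by
    rw [integrableOn_fun_norm_addHaar volume (f := fun y : ℝ => y ^ (-σ)),
      integrableOn_congr_fun (fun y hy => hker y hy.1) measurableSet_Ioo]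
    rw [← integrableOn_Ioc_iff_integrableOn_Ioo, ← intervalIntegrable_iff_integrableOn_Ioc_of_le hR.le]
    exact intervalIntegral.intervalIntegrable_rpow' (by linarith)
  rw [← ofReal_integral_eq_lintegral_ofReal hint
    (Filter.Eventually.of_forall fun ξ => Real.rpow_nonneg (norm_nonneg _) _)]
  congr 1
  have h1 : ∫ ξ in ball (0 : E) R, ‖ξ‖ ^ (-σ) =
      ∫ ξ : E, (Iio R).indicator (fun y : ℝ => y ^ (-σ)) ‖ξ‖ := by
    rw [← integral_indicator measurableSet_ball]
    congr 1
    ext ξ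
    simp [indicator]
  rw [h1, integral_fun_norm_addHaar volume]
  have h2 : ∫ y in Ioi (0 : ℝ), y ^ (d - 1) • (Iio R).indicator (fun y : ℝ => y ^ (-σ)) y =
      ∫ y in (0 : ℝ)..R, y ^ ((d : ℝ) - σ - 1) := by
    rw [intervalIntegral.integral_of_le hR.le, integral_Ioc_eq_integral_Ioo,
      ← Ioi_inter_Iio, ← setIntegral_indicator measurableSet_Iio]
    refine setIntegral_congr_fun measurableSet_Ioi fun y hy => ?_
    by_cases hyR : y < R
    · simpa [indicator, hyR] using hker y hy
    · simp [indicator, hyR]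
  rw [h2, integral_rpow (Or.inl (by linarith))]
  rw [Real.zero_rpow (by linarith)]
  simp
  ring

theorem sq_lintegral_ball_le [Nontrivial E] {σ R : ℝ}
    (hσ : σ < Module.finrank ℝ E) (hR : 0 < R) {g : E → ℂ} (hg : Measurable g) :
    (∫⁻ ξ in ball (0 : E) R, ‖g ξ‖ₑ) ^ 2 ≤
      ENNReal.ofReal (Module.finrank ℝ E * volume.real (ball (0 : E) 1) /
        (Module.finrank ℝ E - σ) * R ^ (Module.finrank ℝ E - σ)) *
      ∫⁻ ξ in ball (0 : E) R, ENNReal.ofReal (‖ξ‖ ^ σ) * ‖g ξ‖ₑ ^ 2 := by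
  rw [← lintegral_ball_norm_rpow_neg hσ hR]
  have hCS := ENNReal.lintegral_mul_le_Lp_mul_Lq (volume.restrict (ball (0 : E) R))
    Real.HolderConjugate.two_two
    (f := fun ξ => ENNReal.ofReal (‖ξ‖ ^ (-σ / 2)))
    (g := fun ξ => ENNReal.ofReal (‖ξ‖ ^ (σ / 2)) * ‖g ξ‖ₑ)
    (by fun_prop) (by fun_prop)
  have h0 : ∀ᵐ ξ ∂(volume.restrict (ball (0 : E) R)), ξ ≠ 0 :=
    ae_restrict_of_ae (Measure.ae_ne volume 0)
  have h1 : ∫⁻ ξ in ball (0 : E) R, ‖g ξ‖ₑ = ∫⁻ ξ in ball (0 : E) R,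
      ENNReal.ofReal (‖ξ‖ ^ (-σ / 2)) * (ENNReal.ofReal (‖ξ‖ ^ (σ / 2)) * ‖g ξ‖ₑ) := by
    refine lintegral_congr_ae (h0.mono fun ξ hξ => ?_)
    have : 0 < ‖ξ‖ := norm_pos_iff.2 hξ
    beta_reduce
    rw [← mul_assoc, ← ENNReal.ofReal_mul (by positivity), ← Real.rpow_add this]
    simp [neg_div]
  have h2 : ∀ a : ℝ, ∀ ξ : E, ENNReal.ofReal (‖ξ‖ ^ (a / 2)) ^ (2 : ℝ) =
      ENNReal.ofReal (‖ξ‖ ^ a) := by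
    intro a ξ
    rw [ENNReal.ofReal_rpow_of_nonneg (by positivity) (by norm_num),
      ← Real.rpow_mul (norm_nonneg _)]
    congr 2
    ring
  have h3 : ∀ x : ℝ≥0∞, (x ^ (1 / 2 : ℝ)) ^ 2 = x := by
    intro x
    rw [← ENNReal.rpow_natCast, ← ENNReal.rpow_mul]
    simp
  rw [h1]
  refine (pow_le_pow_left' hCS 2).trans (le_of_eq ?_)
  rw [mul_pow, h3, h3]
  simp_rw [ENNReal.mul_rpow_of_nonneg _ _ (by norm_num : (0 : ℝ) ≤ 2), h2, ENNReal.rpow_two]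

theorem lintegral_enorm_sq_fourier (f : 𝓢(E, ℂ)) :
    ∫⁻ ξ, ‖𝓕 f ξ‖ₑ ^ 2 = ∫⁻ x, ‖f x‖ₑ ^ 2 := by
  have key : ∀ g : 𝓢(E, ℂ), ∫⁻ x, ‖g x‖ₑ ^ 2 = ENNReal.ofReal (∫ x, ‖g x‖ ^ 2) := by
    intro g
    rw [ofReal_integral_eq_lintegral_ofReal]
    · simp [ENNReal.ofReal_pow]
    · exact (g.memLp 2 volume).integrable_norm_pow (by norm_num)
    · exact Filter.Eventually.of_forall fun x => by positivity
  rw [key, key, SchwartzMap.integral_norm_sq_fourier]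

theorem enorm_le_lintegral_fourier (f : 𝓢(E, ℂ)) (x : E) :
    ‖f x‖ₑ ≤ ∫⁻ ξ, ‖𝓕 f ξ‖ₑ := by
  have h : f x = 𝓕⁻ (𝓕 f) x := by simp
  rw [h, SchwartzMap.fourierInv_coe, Real.fourierInv_eq]
  refine (enorm_integral_le_lintegral_enorm _).trans (le_of_eq ?_)
  congr 1
  ext ξ
  simp [← ofReal_norm]

theorem setLIntegral_enorm_sq_le (f : 𝓢(E, ℂ)) (S : Set E) {R : ℝ} (hR : 0 < R) :
    ∫⁻ x in S, ‖f x‖ₑ ^ 2 ≤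
      2 * (volume S * (∫⁻ ξ in ball (0 : E) (2 * R), ‖𝓕 f ξ‖ₑ) ^ 2) +
        2 * ∫⁻ ξ in {ξ : E | R < ‖ξ‖}, ‖𝓕 f ξ‖ₑ ^ 2 := by
  let χ : ContDiffBump (0 : E) := ⟨R, 2 * R, hR, by linarith⟩
  have hχs : HasCompactSupport (fun ξ => (χ ξ : ℂ)) :=
    χ.hasCompactSupport.comp_left Complex.ofReal_zero
  have hχc : ContDiff ℝ (⊤ : ℕ∞) (fun ξ => (χ ξ : ℂ)) :=
    Complex.ofRealCLM.contDiff.comp χ.contDiff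
  let G : 𝓢(E, ℂ) := (hχs.mul_right (f' := ⇑(𝓕 f : 𝓢(E, ℂ)))).toSchwartzMap (hχc.mul ((𝓕 f : 𝓢(E, ℂ)).smooth ⊤))
  have hG : ∀ ξ, G ξ = χ ξ * 𝓕 f ξ := fun ξ => rfl
  let u : 𝓢(E, ℂ) := 𝓕⁻ G
  have hu : 𝓕 u = G := by simp [u]
  have hlow : ∀ x, ‖u x‖ₑ ≤ ∫⁻ ξ in ball (0 : E) (2 * R), ‖𝓕 f ξ‖ₑ := by
    intro x
    refine (enorm_le_lintegral_fourier u x).trans ?_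
    rw [hu, ← lintegral_indicator measurableSet_ball]
    refine lintegral_mono fun ξ => ?_
    by_cases hξ : ξ ∈ ball (0 : E) (2 * R)
    · rw [indicator_of_mem hξ, hG, enorm_mul]
      refine mul_le_of_le_one_left' ?_
      rw [← ofReal_norm]
      simpa [abs_of_nonneg χ.nonneg] using χ.le_one
    · have : χ ξ = 0 := χ.zero_of_le_dist (by simpa [χ, dist_zero_right] using hξ)
      simp [hG, this]
  have hhigh : ∫⁻ x in S, ‖(f - u) x‖ₑ ^ 2 ≤ ∫⁻ ξ in {ξ : E | R < ‖ξ‖}, ‖𝓕 f ξ‖ₑ ^ 2 := by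
    refine (setLIntegral_le_lintegral _ _).trans ?_
    rw [← lintegral_enorm_sq_fourier,
      ← lintegral_indicator (measurableSet_lt measurable_const measurable_norm)]
    refine lintegral_mono fun ξ => ?_
    have h1 : 𝓕 (f - u) ξ = (1 - χ ξ : ℝ) * 𝓕 f ξ := by
      rw [sub_eq_add_neg, FourierTransform.fourier_add, FourierTransform.fourier_neg, hu]
      simp [hG]
      ring
    by_cases hξ : R < ‖ξ‖
    · rw [indicator_of_mem (by exact hξ), h1, enorm_mul, mul_pow]
      refine mul_le_of_le_one_left' (pow_le_one' ?_ 2)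
      rw [← ofReal_norm, Complex.norm_real, Real.norm_eq_abs,
        abs_of_nonneg (sub_nonneg.2 χ.le_one)]
      simpa using χ.nonneg
    · have : χ ξ = 1 := χ.one_of_mem_closedBall (by simpa [χ] using hξ)
      rw [h1, this]
      simp
  calc ∫⁻ x in S, ‖f x‖ₑ ^ 2
      ≤ ∫⁻ x in S, (2 * (∫⁻ ξ in ball (0 : E) (2 * R), ‖𝓕 f ξ‖ₑ) ^ 2 + 2 * ‖(f - u) x‖ₑ ^ 2) := by
        refine lintegral_mono fun x => ?_
        have h1 : ‖f x‖ₑ ≤ ‖u x‖ₑ + ‖(f - u) x‖ₑ := by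
          refine le_trans (le_of_eq ?_) (enorm_add_le _ _)
          simp
        refine (pow_le_pow_left' h1 2).trans ?_
        have h2 := ENNReal.rpow_add_le_mul_rpow_add_rpow ‖u x‖ₑ ‖(f - u) x‖ₑ
          (p := 2) (by norm_num)
        norm_num [ENNReal.rpow_two] at h2
        refine h2.trans ?_
        rw [mul_add]
        gcongr
        · exact hlow x
        · exact le_rfl
    _ ≤ _ := by
        rw [lintegral_add_right _ (by fun_prop), setLIntegral_const,
          lintegral_const_mul _ (by fun_prop)]
        rw [mul_assoc, mul_comm _ (volume S)]
        gcongr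

theorem lintegral_rpow_neg_mul_meas_lt {X : Type*} [MeasurableSpace X] (ν : Measure X) [SFinite ν]
    {a : X → ℝ} (ha : Measurable a) (hpos : ∀ᵐ x ∂ν, 0 < a x) {p : ℝ} (hp : 1 < p) :
    ∫⁻ t in Ioi (0 : ℝ), ENNReal.ofReal (t ^ (-p)) * ν {x | a x < t} =
      ∫⁻ x, ENNReal.ofReal ((a x) ^ (1 - p) / (p - 1)) ∂ν := by
  have hset : MeasurableSet {z : ℝ × X | a z.2 < z.1} :=
    measurableSet_lt (by fun_prop) (by fun_prop)
  have h1 : ∀ t : ℝ, ENNReal.ofReal (t ^ (-p)) * ν {x | a x < t} =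
      ∫⁻ x, {z : ℝ × X | a z.2 < z.1}.indicator
        (fun z => ENNReal.ofReal (z.1 ^ (-p))) (t, x) ∂ν := by
    intro t
    have : MeasurableSet {x | a x < t} := measurableSet_lt ha measurable_const
    rw [← setLIntegral_const, ← lintegral_indicator this]
    rfl
  simp_rw [h1]
  rw [lintegral_lintegral_swap]
  · refine lintegral_congr_ae (hpos.mono fun x hx => ?_)
    beta_reduce
    have h2 : ∫⁻ t in Ioi (0 : ℝ), {z : ℝ × X | a z.2 < z.1}.indicator
        (fun z => ENNReal.ofReal (z.1 ^ (-p))) (t, x) =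
        ∫⁻ t in Ioi (a x), ENNReal.ofReal (t ^ (-p)) := by
      have h3 : ∀ t : ℝ, {z : ℝ × X | a z.2 < z.1}.indicator
        (fun z => ENNReal.ofReal (z.1 ^ (-p))) (t, x) =
          (Ioi (a x)).indicator (fun t => ENNReal.ofReal (t ^ (-p))) t := fun t => rfl
      simp_rw [h3]
      rw [setLIntegral_indicator measurableSet_Ioi, Ioi_inter_Ioi, max_eq_left hx.le]
    rw [h2, ← ofReal_integral_eq_lintegral_ofReal
      (integrableOn_Ioi_rpow_of_lt (by linarith) hx), integral_Ioi_rpow_of_lt (by linarith) hx]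
    · congr 1
      rw [← neg_div_neg_eq]
      ring_nf
    · filter_upwards [ae_restrict_mem measurableSet_Ioi] with t ht
      exact Real.rpow_nonneg (hx.le.trans (le_of_lt ht)) _
  · refine Measurable.aemeasurable ?_
    exact Measurable.indicator (by fun_prop) hset

theorem exists_lintegral_mul_enorm_sq_le_fourier [Nontrivial E] {m : ℕ} (hm : 1 ≤ m)
    (hd : 2 * m < Module.finrank ℝ E) :
    ∃ K : ℝ, 0 < K ∧ ∀ U : E → ℝ, Measurable U → (∀ x, 0 ≤ U x) →
      (∀ t : ℝ, 0 < t →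
        volume {x | t < U x} ≤ ENNReal.ofReal (t ^ (-((Module.finrank ℝ E : ℝ) / (2 * m))))) →
      ∀ f : 𝓢(E, ℂ), ∫⁻ x, ENNReal.ofReal (U x) * ‖f x‖ₑ ^ 2 ≤
        ENNReal.ofReal K * ∫⁻ ξ, ENNReal.ofReal (‖ξ‖ ^ (2 * m)) * ‖𝓕 f ξ‖ₑ ^ 2 := by
  set d := Module.finrank ℝ E
  have hm0 : (0 : ℝ) < m := by exact_mod_cast hm
  obtain ⟨σ, hσ1, hσ2⟩ : ∃ σ : ℝ, 2 * m < σ ∧ σ < d :=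
    exists_between (by exact_mod_cast hd)
  have hp : 1 < σ / (2 * m) := by rwa [one_lt_div (by positivity)]
  set p := σ / (2 * m) with hp_def
  set c : ℝ := d * volume.real (ball (0 : E) 1) / (d - σ)
  have hc : 0 ≤ c := div_nonneg (by positivity) (by linarith)
  set L : ℝ := c * 2 ^ (d - σ) with hL
  have hL0 : 0 ≤ L := by positivity
  have hp1 : 0 < p - 1 := by linarith
  refine ⟨2 * (L * (2 ^ (σ - 2 * m) / (p - 1))) + 2, by positivity, ?_⟩
  intro U hU hU0 hUw f
  set ν : Measure E := volume.withDensity fun ξ => ENNReal.ofReal (‖ξ‖ ^ σ) * ‖𝓕 f ξ‖ₑ ^ 2 with hν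
  set κ : Measure E := volume.withDensity fun ξ => ‖𝓕 f ξ‖ₑ ^ 2 with hκ
  have hlhs : ∫⁻ x, ENNReal.ofReal (U x) * ‖f x‖ₑ ^ 2 =
      ∫⁻ t in Ioi (0 : ℝ), ∫⁻ x in {x | t < U x}, ‖f x‖ₑ ^ 2 := by
    have h := lintegral_eq_lintegral_meas_lt (volume.withDensity fun x => ‖f x‖ₑ ^ 2)
      (Filter.Eventually.of_forall hU0) hU.aemeasurable
    rw [lintegral_withDensity_eq_lintegral_mul _ (by fun_prop) (by fun_prop)] at h
    calc _ = _ := lintegral_congr fun x => mul_comm _ _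
      _ = _ := h
      _ = _ := lintegral_congr fun t => withDensity_apply _ (measurableSet_lt measurable_const hU)
  have hstep : ∀ t : ℝ, 0 < t → ∫⁻ x in {x | t < U x}, ‖f x‖ₑ ^ 2 ≤
      2 * ENNReal.ofReal L * (ENNReal.ofReal (t ^ (-p)) * ν {ξ | (‖ξ‖ / 2) ^ (2 * m) < t}) +
        2 * κ {ξ | t < ‖ξ‖ ^ (2 * m)} := by
    intro t ht
    set R : ℝ := t ^ (1 / (2 * m : ℝ)) with hR
    have hR0 : 0 < R := by positivity
    have hRt : R ^ (2 * m) = t := by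
      rw [hR, ← Real.rpow_natCast, ← Real.rpow_mul ht.le]
      push_cast
      rw [one_div_mul_cancel (by positivity), Real.rpow_one]
    have hs1 : {ξ : E | (‖ξ‖ / 2) ^ (2 * m) < t} = ball 0 (2 * R) := by
      ext ξ
      rw [mem_ofPred, ← hRt, pow_lt_pow_iff_left₀ (by positivity) hR0.le (by omega),
        mem_ball_zero_iff, div_lt_iff₀ (by norm_num), mul_comm R]
    have hs2 : {ξ : E | t < ‖ξ‖ ^ (2 * m)} = {ξ | R < ‖ξ‖} := by
      ext ξ
      rw [mem_ofPred, mem_ofPred, ← hRt, pow_lt_pow_iff_left₀ hR0.le (by positivity) (by omega)]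
    refine (setLIntegral_enorm_sq_le f _ hR0).trans ?_
    rw [hs1, hs2, hν, hκ, withDensity_apply _ measurableSet_ball,
      withDensity_apply _ (measurableSet_lt measurable_const measurable_norm)]
    gcongr ?_ + _
    rw [mul_assoc]
    gcongr 2 * ?_
    refine (mul_le_mul' (hUw t ht) (sq_lintegral_ball_le hσ2 (R := 2 * R) (by positivity)
      (g := fun ξ => 𝓕 f ξ) (by fun_prop))).trans (le_of_eq ?_)
    rw [← mul_assoc, ← mul_assoc, ← ENNReal.ofReal_mul (by positivity),
      ← ENNReal.ofReal_mul hL0]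
    congr 2
    rw [Real.mul_rpow (by norm_num) hR0.le, hR, ← Real.rpow_mul ht.le, hL]
    have : t ^ (-p) = t ^ (-((d : ℝ) / (2 * m))) * t ^ (1 / (2 * m : ℝ) * (d - σ)) := by
      rw [← Real.rpow_add ht]
      congr 1
      rw [hp_def]
      field_simp
      ring
    rw [this]
    ring
  have h0 : ∀ᵐ ξ : E, ξ ≠ 0 := Measure.ae_ne volume 0
  have hν_int : ∫⁻ t in Ioi (0 : ℝ), ENNReal.ofReal (t ^ (-p)) * ν {ξ | (‖ξ‖ / 2) ^ (2 * m) < t} =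
      ENNReal.ofReal (2 ^ (σ - 2 * m) / (p - 1)) *
        ∫⁻ ξ, ENNReal.ofReal (‖ξ‖ ^ (2 * m)) * ‖𝓕 f ξ‖ₑ ^ 2 := by
    rw [lintegral_rpow_neg_mul_meas_lt ν (by fun_prop) _ hp, hν,
      lintegral_withDensity_eq_lintegral_mul _ (by fun_prop) (by fun_prop),
      ← lintegral_const_mul _ (by fun_prop)]
    · refine lintegral_congr_ae (h0.mono fun ξ hξ => ?_)
      have hξ0 : 0 < ‖ξ‖ := norm_pos_iff.2 hξ
      simp only [Pi.mul_apply]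
      rw [mul_right_comm, ← mul_assoc, ← ENNReal.ofReal_mul (by positivity),
        ← ENNReal.ofReal_mul (by positivity)]
      congr 2
      have h1 : ((‖ξ‖ / 2) ^ (2 * m)) ^ (1 - p) = ‖ξ‖ ^ (2 * m - σ) * 2 ^ (σ - 2 * m) := by
        rw [← Real.rpow_natCast, ← Real.rpow_mul (by positivity)]
        have : ((2 * m : ℕ) : ℝ) * (1 - p) = 2 * m - σ := by
          rw [hp_def]
          push_cast
          field_simp
        rw [this, Real.div_rpow hξ0.le (by norm_num), div_eq_mul_inv,
          ← Real.rpow_neg (by norm_num), neg_sub]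
      have h2 : ‖ξ‖ ^ (2 * m) = ‖ξ‖ ^ σ * ‖ξ‖ ^ (2 * m - σ) := by
        rw [← Real.rpow_add hξ0, ← Real.rpow_natCast]
        congr 1
        push_cast
        ring
      rw [h1, h2]
      ring
    · refine (withDensity_absolutelyContinuous _ _).ae_le (h0.mono fun ξ hξ => ?_)
      have hξ0 : 0 < ‖ξ‖ := norm_pos_iff.2 hξ
      positivity
  have hκ_int : ∫⁻ t in Ioi (0 : ℝ), κ {ξ | t < ‖ξ‖ ^ (2 * m)} =
      ∫⁻ ξ, ENNReal.ofReal (‖ξ‖ ^ (2 * m)) * ‖𝓕 f ξ‖ₑ ^ 2 := by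
    rw [← lintegral_eq_lintegral_meas_lt κ (Filter.Eventually.of_forall fun ξ => by positivity)
      (by fun_prop), hκ, lintegral_withDensity_eq_lintegral_mul _ (by fun_prop) (by fun_prop),
      mul_comm]
    rfl
  have hmeas : Measurable fun t : ℝ => κ {ξ | t < ‖ξ‖ ^ (2 * m)} :=
    Antitone.measurable fun s t hst => measure_mono fun ξ hξ => lt_of_le_of_lt hst hξ
  rw [hlhs]
  refine (setLIntegral_mono' measurableSet_Ioi fun t ht => hstep t ht).trans ?_
  rw [lintegral_add_right _ (hmeas.const_mul 2), lintegral_const_mul' _ _ (by finiteness),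
    lintegral_const_mul' _ _ (by finiteness), hν_int, hκ_int,
    ENNReal.ofReal_add (by positivity) (by positivity), add_mul,
    ENNReal.ofReal_mul zero_le_two, ENNReal.ofReal_mul hL0, ENNReal.ofReal_ofNat]
  simp only [mul_assoc]
  exact le_rfl

theorem fourier_iteratedLineDerivOp_const (e : E) (n : ℕ) (f : 𝓢(E, ℂ)) (ξ : E) :
    𝓕 (∂^{fun _ : Fin n => e} f) ξ = (2 * Real.pi * Complex.I * (inner ℝ ξ e : ℝ)) ^ n * 𝓕 f ξ := by
  have he : (inner ℝ · e : E → ℝ).HasTemperateGrowth := ((innerSL ℝ).flip e).hasTemperateGrowth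
  induction n with
  | zero => simp
  | succ n ih =>
    rw [iteratedLineDerivOp_succ_left, SchwartzMap.fourier_lineDerivOp_eq]
    simp only [smul_apply, SchwartzMap.smulLeftCLM_apply_apply he]
    have : Fin.tail (fun _ : Fin (n + 1) => e) = fun _ : Fin n => e := rfl
    rw [this, ih]
    simp
    ring

end FourierInequalities

theorem norm_pow_two_mul_le_sum {N m : ℕ} (hm : 1 ≤ m) (hN : 0 < N)
    (ξ : EuclideanSpace ℝ (Fin N)) :
    ‖ξ‖ ^ (2 * m) ≤ (N : ℝ) ^ (m - 1) * ∑ j, |ξ j| ^ (2 * m) := by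
  obtain ⟨n, rfl⟩ : ∃ n, m = n + 1 := ⟨m - 1, by omega⟩
  have h := pow_sum_div_card_le_sum_pow (s := Finset.univ) (f := fun j => |ξ j| ^ 2)
    (fun j _ => by positivity) n
  rw [Finset.card_univ, Fintype.card_fin, div_le_iff₀ (by positivity)] at h
  rw [pow_mul, EuclideanSpace.norm_sq_eq]
  simp only [Real.norm_eq_abs, pow_mul, Nat.add_sub_cancel]
  rwa [mul_comm]

theorem lintegral_norm_pow_mul_fourier_le {N m : ℕ} (hm : 1 ≤ m) (hN : 0 < N)
    (f : 𝓢(EuclideanSpace ℝ (Fin N), ℂ)) :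
    ∫⁻ ξ, ENNReal.ofReal (‖ξ‖ ^ (2 * m)) * ‖𝓕 f ξ‖ₑ ^ 2 ≤
      ENNReal.ofReal ((N : ℝ) ^ m) * ∫⁻ x, ‖iteratedFDeriv ℝ m f x‖ₑ ^ 2 := by
  have hj : ∀ j : Fin N, ∫⁻ ξ : EuclideanSpace ℝ (Fin N),
      ENNReal.ofReal (|ξ j| ^ (2 * m)) * ‖𝓕 f ξ‖ₑ ^ 2 ≤
        ∫⁻ x, ‖iteratedFDeriv ℝ m f x‖ₑ ^ 2 := by
    intro j
    set e : EuclideanSpace ℝ (Fin N) := EuclideanSpace.single j 1 with he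
    calc _ ≤ ∫⁻ ξ, ‖𝓕 (∂^{fun _ : Fin m => e} f) ξ‖ₑ ^ 2 := by
          refine lintegral_mono fun ξ => ?_
          rw [fourier_iteratedLineDerivOp_const, enorm_mul, mul_pow]
          gcongr
          rw [← ofReal_norm, ← ENNReal.ofReal_pow (norm_nonneg _)]
          refine ENNReal.ofReal_le_ofReal ?_
          rw [norm_pow, ← pow_mul, mul_comm m 2]
          gcongr
          have : inner ℝ ξ e = ξ j := by simp [he, EuclideanSpace.inner_single_right]
          rw [this]
          simp only [Complex.norm_mul, Complex.norm_I, Complex.norm_real, Complex.norm_ofNat,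
            Real.norm_eq_abs, mul_one, abs_of_pos Real.pi_pos]
          have := Real.pi_gt_three
          nlinarith [abs_nonneg (ξ j)]
      _ = ∫⁻ x, ‖(∂^{fun _ : Fin m => e} f) x‖ₑ ^ 2 := lintegral_enorm_sq_fourier _
      _ ≤ _ := by
          refine lintegral_mono fun x => ?_
          gcongr
          rw [SchwartzMap.iteratedLineDerivOp_eq_iteratedFDeriv, ← ofReal_norm, ← ofReal_norm]
          refine ENNReal.ofReal_le_ofReal ?_
          simpa [he] using (iteratedFDeriv ℝ m f x).le_opNorm fun _ => e
  calc _ ≤ ∫⁻ ξ, ENNReal.ofReal ((N : ℝ) ^ (m - 1)) *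
        ∑ j, ENNReal.ofReal (|ξ j| ^ (2 * m)) * ‖𝓕 f ξ‖ₑ ^ 2 := by
        refine lintegral_mono fun ξ => ?_
        rw [← Finset.sum_mul, ← ENNReal.ofReal_sum_of_nonneg (fun j _ => by positivity),
          ← mul_assoc, ← ENNReal.ofReal_mul (by positivity)]
        gcongr
        exact norm_pow_two_mul_le_sum hm hN ξ
    _ = ENNReal.ofReal ((N : ℝ) ^ (m - 1)) *
        ∑ j, ∫⁻ ξ : EuclideanSpace ℝ (Fin N),
          ENNReal.ofReal (|ξ j| ^ (2 * m)) * ‖𝓕 f ξ‖ₑ ^ 2 := by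
        rw [lintegral_const_mul' _ _ (by finiteness), lintegral_finsetSum]
        intro j _
        fun_prop
    _ ≤ ENNReal.ofReal ((N : ℝ) ^ (m - 1)) *
        ∑ _j : Fin N, ∫⁻ x, ‖iteratedFDeriv ℝ m f x‖ₑ ^ 2 := by
        exact mul_le_mul_right (Finset.sum_le_sum fun j _ => hj j) _
    _ = _ := by
        rw [Finset.sum_const, Finset.card_univ, Fintype.card_fin, nsmul_eq_mul, ← mul_assoc,
          ← ENNReal.ofReal_natCast, ← ENNReal.ofReal_mul (by positivity), ← pow_succ,
          Nat.sub_add_cancel hm]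

/-- The Strichartz inequality: multiplication by the square root of a function in weak
`L^{N/(2m)}` is bounded from the homogeneous Sobolev space of order `m` to `L²`. -/
theorem exists_lintegral_mul_enorm_sq_le_iteratedFDeriv {m N : ℕ} (hm : 1 ≤ m) (hN : 2 * m < N) :
    ∃ C : ℝ, 0 < C ∧ ∀ V : EuclideanSpace ℝ (Fin N) → ℝ, Measurable V →
      ∀ W : ℝ, 0 < W → weakLpNorm volume ((N : ℝ) / (2 * m)) V ≤ ENNReal.ofReal W →
      ∀ f : 𝓢(EuclideanSpace ℝ (Fin N), ℂ), ∫⁻ x, ENNReal.ofReal |V x| * ‖f x‖ₑ ^ 2 ≤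
        ENNReal.ofReal (C * W) * ∫⁻ x, ‖iteratedFDeriv ℝ m f x‖ₑ ^ 2 := by
  have hN0 : 0 < N := by omega
  have : Nonempty (Fin N) := ⟨⟨0, hN0⟩⟩
  obtain ⟨K, hK, h⟩ := exists_lintegral_mul_enorm_sq_le_fourier
    (E := EuclideanSpace ℝ (Fin N)) hm (by simpa using hN)
  refine ⟨K * (N : ℝ) ^ m, by positivity, fun V hV W hW hVW f => ?_⟩
  have hr : (0 : ℝ) < (N : ℝ) / (2 * m) := by
    have : (0 : ℝ) < m := by exact_mod_cast hm
    positivity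
  set r : ℝ := (N : ℝ) / (2 * m) with hr_def
  have hU : ∀ t : ℝ, 0 < t → volume {x | t < |V x| / W} ≤ ENNReal.ofReal (t ^ (-r)) := by
    intro t ht
    have h1 : ENNReal.ofReal (t * W) * volume {x | t * W < |V x|} ^ (1 / r) ≤ ENNReal.ofReal W :=
      (le_iSup₂ (f := fun (γ : ℝ) (_ : 0 < γ) =>
        ENNReal.ofReal γ * volume {x | γ < |V x|} ^ (1 / r)) (t * W) (by positivity)).trans hVW
    have h2 : volume {x | t * W < |V x|} ^ (1 / r) ≤ ENNReal.ofReal (t⁻¹) := by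
      have h3 : ENNReal.ofReal W = ENNReal.ofReal (t * W) * ENNReal.ofReal (t⁻¹) := by
        rw [← ENNReal.ofReal_mul (by positivity)]
        congr 1
        field_simp
      rw [h3] at h1
      exact (ENNReal.mul_le_mul_iff_right (by positivity) (by finiteness)).1 h1
    have h4 := ENNReal.rpow_le_rpow h2 hr.le
    rw [← ENNReal.rpow_mul, one_div_mul_cancel hr.ne', ENNReal.rpow_one,
      ENNReal.ofReal_rpow_of_pos (by positivity), Real.inv_rpow ht.le,
      ← Real.rpow_neg ht.le] at h4
    simpa only [lt_div_iff₀ hW] using h4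
  have h5 := h (fun x => |V x| / W) (by fun_prop) (fun x => by positivity)
    (by simpa [← hr_def] using hU) f
  calc _ = ENNReal.ofReal W * ∫⁻ x, ENNReal.ofReal (|V x| / W) * ‖f x‖ₑ ^ 2 := by
        rw [← lintegral_const_mul' _ _ (by finiteness)]
        refine lintegral_congr fun x => ?_
        rw [← mul_assoc, ← ENNReal.ofReal_mul hW.le, mul_div_cancel₀ _ hW.ne']
    _ ≤ ENNReal.ofReal W * (ENNReal.ofReal K * (ENNReal.ofReal ((N : ℝ) ^ m) *
        ∫⁻ x, ‖iteratedFDeriv ℝ m f x‖ₑ ^ 2)) := by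
        gcongr
        exact h5.trans (by gcongr; exact lintegral_norm_pow_mul_fourier_le hm hN0 f)
    _ = _ := by
        rw [mul_comm _ W, ENNReal.ofReal_mul hW.le, ENNReal.ofReal_mul hK.le]
        ring

/-- for `N > 2m` there is `C = C(m,N) > 0` such that whenever `Q₀`
satisfies the lower Gårding bound with constant `ρ > 0` and
`C ‖V‖_{L^{N/2m,∞}} < ρ`, the potential `V` is strongly subcritical relative to
`Q₀` with constant `μ = C ‖V‖_{L^{N/2m,∞}} / ρ < 1`. -/
theorem stmt_11 (m N : ℕ) (hm : 1 ≤ m) (hN : 2 * m < N) :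
    ∃ C : ℝ, 0 < C ∧
      ∀ ρ : ℝ, 0 < ρ →
        ∀ a : (Fin N → ℕ) → (Fin N → ℕ) → EuclideanSpace ℝ (Fin N) → ℂ,
          (∀ α β, α ∈ multiIdx N m → β ∈ multiIdx N m →
            Measurable (a α β) ∧ ∃ M : ℝ, ∀ x, ‖a α β x‖ ≤ M) →
          (∀ f : EuclideanSpace ℝ (Fin N) → ℂ,
            ContDiff ℝ (⊤ : ℕ∞) f → HasCompactSupport f →
            ρ * ∫ x, ‖iteratedFDeriv ℝ m f x‖ ^ 2 ≤ (Qform m a f f).re) →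
          ∀ V : EuclideanSpace ℝ (Fin N) → ℝ, Measurable V →
            ENNReal.ofReal C * weakLpNorm volume ((N : ℝ) / (2 * m)) V <
              ENNReal.ofReal ρ →
            C * (weakLpNorm volume ((N : ℝ) / (2 * m)) V).toReal / ρ < 1 ∧
              ∀ f : EuclideanSpace ℝ (Fin N) → ℂ,
                ContDiff ℝ (⊤ : ℕ∞) f → HasCompactSupport f →
                (∫⁻ x, ENNReal.ofReal (max (-V x) 0) * (‖f x‖₊ : ℝ≥0∞) ^ 2) ≤
                  ENNReal.ofReal
                      (C * (weakLpNorm volume ((N : ℝ) / (2 * m)) V).toReal / ρ) *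
                    (ENNReal.ofReal ((Qform m a f f).re) +
                      ∫⁻ x, ENNReal.ofReal (max (V x) 0) * (‖f x‖₊ : ℝ≥0∞) ^ 2) := by
  obtain ⟨C, hC, h⟩ := exists_lintegral_mul_enorm_sq_le_iteratedFDeriv hm hN
  refine ⟨C, hC, fun ρ hρ a _ hQ V hV hlt => ?_⟩
  set w := weakLpNorm volume ((N : ℝ) / (2 * m)) V
  have hw : w ≠ ⊤ := by
    rintro hw
    rw [hw, ENNReal.mul_top (by simpa using hC)] at hlt
    exact not_top_lt hlt
  refine ⟨?_, fun f hf hfc => ?_⟩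
  · rw [div_lt_one hρ]
    rw [← ENNReal.ofReal_toReal hw, ← ENNReal.ofReal_mul hC.le] at hlt
    exact (ENNReal.ofReal_lt_ofReal_iff hρ).1 hlt
  have hint : Integrable fun x => ‖iteratedFDeriv ℝ m f x‖ ^ 2 := by
    refine Continuous.integrable_of_hasCompactSupport
      ((hf.continuous_iteratedFDeriv (by exact_mod_cast le_top)).norm.pow 2) ?_
    exact (hfc.iteratedFDeriv m).comp_left (g := fun y => ‖y‖ ^ 2) (by simp)
  have hJ : ∫⁻ x, ‖iteratedFDeriv ℝ m f x‖ₑ ^ 2 =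
      ENNReal.ofReal (∫ x, ‖iteratedFDeriv ℝ m f x‖ ^ 2) := by
    rw [ofReal_integral_eq_lintegral_ofReal hint
      (Filter.Eventually.of_forall fun x => by positivity)]
    simp [ENNReal.ofReal_pow]
  have hbound : ∀ W : ℝ, w.toReal < W →
      ∫⁻ x, ENNReal.ofReal |V x| * ‖f x‖ₑ ^ 2 ≤
        ENNReal.ofReal (C * W) * ENNReal.ofReal (∫ x, ‖iteratedFDeriv ℝ m f x‖ ^ 2) := by
    intro W hW
    rw [← hJ]
    exact h V hV W (ENNReal.toReal_nonneg.trans_lt hW)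
      ((ENNReal.ofReal_toReal hw).symm.le.trans (ENNReal.ofReal_le_ofReal hW.le))
      (hfc.toSchwartzMap hf)
  have hlim : ∫⁻ x, ENNReal.ofReal |V x| * ‖f x‖ₑ ^ 2 ≤
      ENNReal.ofReal (C * w.toReal) *
        ENNReal.ofReal (∫ x, ‖iteratedFDeriv ℝ m f x‖ ^ 2) := by
    refine ge_of_tendsto (x := nhdsWithin w.toReal (Ioi w.toReal))
      (f := fun W => ENNReal.ofReal (C * W) *
        ENNReal.ofReal (∫ x, ‖iteratedFDeriv ℝ m f x‖ ^ 2)) ?_ ?_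
    · refine ENNReal.Tendsto.mul_const ?_ (Or.inr ENNReal.ofReal_ne_top)
      exact ((ENNReal.continuous_ofReal.comp (continuous_const.mul continuous_id)).tendsto
        _).mono_left nhdsWithin_le_nhds
    · filter_upwards [self_mem_nhdsWithin] with W hW using hbound W hW
  calc _ ≤ ∫⁻ x, ENNReal.ofReal |V x| * ‖f x‖ₑ ^ 2 := by
        refine lintegral_mono fun x => ?_
        exact mul_le_mul_left (ENNReal.ofReal_le_ofReal
          (max_le (neg_le_abs _) (abs_nonneg _))) _
    _ ≤ _ := hlim
    _ = ENNReal.ofReal (C * w.toReal / ρ) *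
        ENNReal.ofReal (ρ * ∫ x, ‖iteratedFDeriv ℝ m f x‖ ^ 2) := by
        have : 0 ≤ w.toReal := ENNReal.toReal_nonneg
        rw [← ENNReal.ofReal_mul (by positivity), ← ENNReal.ofReal_mul (by positivity)]
        congr 1
        field_simp
    _ ≤ ENNReal.ofReal (C * w.toReal / ρ) * ENNReal.ofReal ((Qform m a f f).re) := by
        gcongr
        exact hQ f hf hfc
    _ ≤ _ := by
        gcongr
        exact le_self_add
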